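/- Let (X,B) be a marked space. For every n ≥ 0 and every coefficient ring R, the inclusion of marked chains into relative singular chains induces an isomorphism H^M_n(X,B;R) → H_n(X,B;R) between marked homology and relative singular homology of the pair (X,B). -/

import Mathlib

open scoped BigOperators
open Topology
noncomputable section

/-! ### Quasicones and marked spaces -/

/-- `B` is a *quasicone* with apex `b`: there is a homotopy `H` from the identity to the
constant map at `b` with `H ⁻¹' {b} = ({b} × I) ∪ (B × {1})`. -/
def IsQuasicone {B : Type*} [TopologicalSpace B] (b : B) : Prop :=
  ∃ H : C(B × unitInterval, B),
    (∀ x, H (x, 0) = x) ∧ (∀ x, H (x, 1) = b) ∧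
    (∀ x t, H (x, t) = b ↔ x = b ∨ t = 1)

/-- A *marked space* `(X, B)`: `B` is closed in `X` and every `b ∈ B` has a closed
quasiconical neighbourhood `F b` with apex `b`, the `F b` being pairwise disjoint. -/
structure IsMarkedSpace (X : Type*) [TopologicalSpace X] (B : Set X) : Prop where
  closed : IsClosed B
  quasicones : ∃ F : B → Set X,
    (∀ b : B, IsClosed (F b)) ∧ (∀ b : B, F b ∈ nhds (b : X)) ∧
    (∀ b b' : B, b ≠ b' → Disjoint (F b) (F b')) ∧
    (∀ b : B, ∃ hb : (b : X) ∈ F b, IsQuasicone (⟨(b : X), hb⟩ : F b))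

/-! ### Singular chains -/

/-- The topological standard `n`-simplex. -/
abbrev TopSimplex (n : ℕ) : Type := ↥(stdSimplex ℝ (Fin (n + 1)))

/-- Singular `n`-simplices in `X`. -/
abbrev SingularSimplex (X : Type*) [TopologicalSpace X] (n : ℕ) := C(TopSimplex n, X)

/-- Singular `n`-chains in `X` with coefficients in `R`. -/
abbrev SingularChain (R : Type*) [Ring R] (X : Type*) [TopologicalSpace X] (n : ℕ) :=
  SingularSimplex X n →₀ R

/-- The `i`-th coface map, on barycentric coordinates. -/
def cofaceFun {n : ℕ} (i : Fin (n + 2)) (x : Fin (n + 1) → ℝ) : Fin (n + 2) → ℝ :=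
  fun j => ∑ k : Fin (n + 1), if i.succAbove k = j then x k else 0

lemma cofaceFun_mem {n : ℕ} (i : Fin (n + 2)) {x : Fin (n + 1) → ℝ}
    (hx : x ∈ stdSimplex ℝ (Fin (n + 1))) : cofaceFun i x ∈ stdSimplex ℝ (Fin (n + 2)) := by
  constructor
  · intro j
    refine Finset.sum_nonneg fun k _ => ?_
    split_ifs
    · exact hx.1 k
    · exact le_rfl
  · unfold cofaceFun
    rw [Finset.sum_comm]
    simp only [Finset.sum_ite_eq, Finset.mem_univ, if_true]
    exact hx.2

/-- The `i`-th face inclusion `Δⁿ → Δⁿ⁺¹`. -/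
def coface {n : ℕ} (i : Fin (n + 2)) : C(TopSimplex n, TopSimplex (n + 1)) where
  toFun x := ⟨cofaceFun i (x : Fin (n + 1) → ℝ), cofaceFun_mem i x.2⟩
  continuous_toFun := by
    refine Continuous.subtype_mk ?_ _
    refine continuous_pi fun j => ?_
    unfold cofaceFun
    refine continuous_finset_sum _ fun k _ => ?_
    by_cases h : i.succAbove k = j
    · simp only [if_pos h]
      exact (continuous_apply k).comp continuous_subtype_val
    · simp only [if_neg h]
      exact continuous_const

/-- The boundary of a single `(n+1)`-simplex. -/
def boundaryOf (R : Type*) [Ring R] {X : Type*} [TopologicalSpace X] {n : ℕ}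
    (σ : SingularSimplex X (n + 1)) : SingularChain R X n :=
  ∑ i : Fin (n + 2), Finsupp.single (σ.comp (coface i)) ((-1 : R) ^ (i : ℕ))

/-- The singular boundary operator. -/
def boundary (R : Type*) [Ring R] (X : Type*) [TopologicalSpace X] (n : ℕ) :
    SingularChain R X (n + 1) →ₗ[R] SingularChain R X n :=
  Finsupp.lsum ℕ fun σ => LinearMap.toSpanSingleton R _ (boundaryOf R σ)

/-- Push-forward of chains along a continuous map. -/
def pushChain (R : Type*) [Ring R] {X Y : Type*} [TopologicalSpace X] [TopologicalSpace Y]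
    (f : C(X, Y)) (n : ℕ) : SingularChain R X n →ₗ[R] SingularChain R Y n :=
  Finsupp.lmapDomain R R fun σ : SingularSimplex X n => f.comp σ

/-- The face of `Δⁿ` spanned by the vertices in `S`. -/
def faceSet (n : ℕ) (S : Finset (Fin (n + 1))) : Set (TopSimplex n) :=
  {x | ∀ j ∉ S, (x : Fin (n + 1) → ℝ) j = 0}

/-- A subset of `Δⁿ` which is a union of (not necessarily proper) faces. -/
def IsSimplicialSubcomplex {n : ℕ} (A : Set (TopSimplex n)) : Prop :=
  ∃ 𝒮 : Set (Finset (Fin (n + 1))), A = ⋃ S ∈ 𝒮, faceSet n S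

/-- A singular simplex is *admissible* if the preimage of `B` is a union of faces. -/
def Admissible {X : Type*} [TopologicalSpace X] (B : Set X) {n : ℕ}
    (σ : SingularSimplex X n) : Prop :=
  IsSimplicialSubcomplex (σ ⁻¹' B)

/-- The submodule generated by admissible simplices. -/
def admissibleChains (R : Type*) [Ring R] (X : Type*) [TopologicalSpace X] (B : Set X)
    (n : ℕ) : Submodule R (SingularChain R X n) :=
  Submodule.span R {c | ∃ σ : SingularSimplex X n, Admissible B σ ∧ c = Finsupp.single σ 1}

/-- The submodule generated by simplices supported in `B`. -/
def chainsIn (R : Type*) [Ring R] (X : Type*) [TopologicalSpace X] (B : Set X)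
    (n : ℕ) : Submodule R (SingularChain R X n) :=
  Submodule.span R {c | ∃ σ : SingularSimplex X n, Set.range ⇑σ ⊆ B ∧ c = Finsupp.single σ 1}

/-- Cycles of the marked chain complex `C^M_*(X,B;R) = Ĉ^M_*(X,B;R)/C_*(B;R)`:
admissible chains whose boundary is supported in `B`. -/
def markedCycles (R : Type*) [Ring R] (X : Type*) [TopologicalSpace X] (B : Set X) :
    (n : ℕ) → Submodule R (SingularChain R X n)
  | 0 => admissibleChains R X B 0
  | (n + 1) => admissibleChains R X B (n + 1) ⊓
      Submodule.comap (boundary R X n) (chainsIn R X B n)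

/-- Boundaries of the marked chain complex. -/
def markedBoundaries (R : Type*) [Ring R] (X : Type*) [TopologicalSpace X] (B : Set X)
    (n : ℕ) : Submodule R (SingularChain R X n) :=
  Submodule.map (boundary R X n) (admissibleChains R X B (n + 1)) ⊔ chainsIn R X B n

/-- Relative cycles of the pair `(X, B)`. -/
def relativeCycles (R : Type*) [Ring R] (X : Type*) [TopologicalSpace X] (B : Set X) :
    (n : ℕ) → Submodule R (SingularChain R X n)
  | 0 => ⊤
  | (n + 1) => Submodule.comap (boundary R X n) (chainsIn R X B n)

/-- Relative boundaries of the pair `(X, B)`. -/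
def relativeBoundaries (R : Type*) [Ring R] (X : Type*) [TopologicalSpace X] (B : Set X)
    (n : ℕ) : Submodule R (SingularChain R X n) :=
  Submodule.map (boundary R X n) ⊤ ⊔ chainsIn R X B n

/-- The ℓ¹-norm of a real singular chain. -/
def l1Norm {X : Type*} [TopologicalSpace X] {n : ℕ} (c : SingularChain ℝ X n) : ℝ :=
  c.sum fun _ r => |r|

/-! ### Faces and boundaries -/

lemma cofaceFun_succAbove {n : ℕ} (i : Fin (n + 2)) (x : Fin (n + 1) → ℝ) (k : Fin (n + 1)) :
    cofaceFun i x (i.succAbove k) = x k := by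
  simp [cofaceFun]

lemma cofaceFun_self {n : ℕ} (i : Fin (n + 2)) (x : Fin (n + 1) → ℝ) :
    cofaceFun i x i = 0 := by
  simp [cofaceFun]

lemma cofaceFun_cofaceFun {n : ℕ} (i : Fin (n + 3)) (j : Fin (n + 2)) (x : Fin (n + 1) → ℝ)
    (l : Fin (n + 3)) :
    cofaceFun i (cofaceFun j x) l =
      ∑ k, if i.succAbove (j.succAbove k) = l then x k else 0 := by
  rcases Fin.eq_self_or_eq_succAbove i l with rfl | ⟨m, rfl⟩
  · simp [cofaceFun_self]
  · simp [cofaceFun]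

lemma coface_comp_coface {n : ℕ} (i : Fin (n + 3)) (j : Fin (n + 2)) :
    (coface (i.succAbove j)).comp (coface (j.predAbove i)) = (coface i).comp (coface j) := by
  ext x l
  change cofaceFun _ (cofaceFun _ _) l = cofaceFun _ (cofaceFun _ _) l
  simp_rw [cofaceFun_cofaceFun, Fin.succAbove_succAbove_succAbove_predAbove]

section Chains

variable {R : Type*} [Ring R] {X Y : Type*} [TopologicalSpace X] [TopologicalSpace Y]

lemma boundary_single {n : ℕ} (σ : SingularSimplex X (n + 1)) :
    boundary R X n (Finsupp.single σ 1) =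
      ∑ i : Fin (n + 2), (-1 : R) ^ (i : ℕ) • Finsupp.single (σ.comp (coface i)) 1 := by
  simp [boundary, boundaryOf]

lemma pushChain_single (f : C(X, Y)) {n : ℕ} (σ : SingularSimplex X n) (r : R) :
    pushChain R f n (Finsupp.single σ r) = Finsupp.single (f.comp σ) r := by
  simp [pushChain]

lemma chain_hom_ext {n : ℕ} {M : Type*} [AddCommMonoid M] [Module R M]
    {f g : SingularChain R X n →ₗ[R] M}
    (h : ∀ σ, f (Finsupp.single σ 1) = g (Finsupp.single σ 1)) : f = g :=
  Finsupp.lhom_ext' fun σ => LinearMap.ext_ring (h σ)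

lemma boundary_pushChain (f : C(X, Y)) (n : ℕ) (c : SingularChain R X (n + 1)) :
    boundary R Y n (pushChain R f (n + 1) c) = pushChain R f n (boundary R X n c) := by
  suffices h : boundary R Y n ∘ₗ pushChain R f (n + 1) = pushChain R f n ∘ₗ boundary R X n from
    LinearMap.congr_fun h c
  refine chain_hom_ext fun σ => ?_
  simp [pushChain_single, boundary_single, ContinuousMap.comp_assoc]

lemma boundary_boundary (n : ℕ) (c : SingularChain R X (n + 2)) :
    boundary R X n (boundary R X (n + 1) c) = 0 := by
  suffices h : boundary R X n ∘ₗ boundary R X (n + 1) = 0 from LinearMap.congr_fun h c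
  refine chain_hom_ext fun σ => ?_
  simp only [LinearMap.comp_apply, boundary_single, map_sum, map_smul, Finset.smul_sum,
    smul_smul, ← pow_add, LinearMap.zero_apply, ContinuousMap.comp_assoc]
  rw [← Finset.sum_product' (f := fun (i : Fin (n + 3)) (j : Fin (n + 2)) =>
    (-1 : R) ^ ((i : ℕ) + (j : ℕ)) • Finsupp.single (σ.comp ((coface i).comp (coface j))) (1 : R))]
  refine Finset.sum_involution (fun p _ => (p.1.succAbove p.2, p.2.predAbove p.1)) ?_ ?_ ?_ ?_
  · rintro ⟨i, j⟩ -
    simp only [coface_comp_coface, Fin.neg_one_pow_succAbove_add_predAbove, neg_smul]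
    exact add_neg_cancel _
  · rintro ⟨i, j⟩ - - h
    exact Fin.succAbove_ne i j (congrArg Prod.fst h)
  · simp
  · rintro ⟨i, j⟩ -
    simp [Fin.succAbove_succAbove_predAbove, Fin.predAbove_predAbove_succAbove]

/-- Chains all of whose simplices lie in `S`. -/
abbrev chainsOf (R : Type*) [Ring R] {n : ℕ} (S : Set (SingularSimplex X n)) :
    Submodule R (SingularChain R X n) :=
  Submodule.span R {c | ∃ σ, σ ∈ S ∧ c = Finsupp.single σ 1}

lemma single_mem_chainsOf {n : ℕ} {S : Set (SingularSimplex X n)} {σ : SingularSimplex X n}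
    (h : σ ∈ S) : Finsupp.single σ 1 ∈ chainsOf R S :=
  Submodule.subset_span ⟨σ, h, rfl⟩

lemma map_mem_of_mem_chainsOf {n : ℕ} {S : Set (SingularSimplex X n)} {M : Type*}
    [AddCommMonoid M] [Module R M] (f : SingularChain R X n →ₗ[R] M) (N : Submodule R M)
    (h : ∀ σ ∈ S, f (Finsupp.single σ 1) ∈ N) {c : SingularChain R X n}
    (hc : c ∈ chainsOf R S) : f c ∈ N := by
  have : chainsOf R S ≤ N.comap f := Submodule.span_le.2 <| by
    rintro _ ⟨σ, hσ, rfl⟩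
    exact h σ hσ
  exact this hc

lemma pushChain_mem_chainsOf {n : ℕ} {S : Set (SingularSimplex X n)}
    {S' : Set (SingularSimplex Y n)} (f : C(X, Y)) (h : ∀ σ ∈ S, f.comp σ ∈ S')
    {c : SingularChain R X n} (hc : c ∈ chainsOf R S) : pushChain R f n c ∈ chainsOf R S' :=
  map_mem_of_mem_chainsOf _ _
    (fun σ hσ => by rw [pushChain_single]; exact single_mem_chainsOf (h σ hσ)) hc

lemma chainsOf_univ (n : ℕ) :
    chainsOf R (Set.univ : Set (SingularSimplex X n)) = ⊤ := by
  refine eq_top_iff.2 fun c _ => ?_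
  induction c using Finsupp.induction_linear with
  | zero => exact zero_mem _
  | add f g hf hg => exact add_mem (hf trivial) (hg trivial)
  | single σ r =>
    rw [← mul_one r, ← smul_eq_mul, ← Finsupp.smul_single]
    exact Submodule.smul_mem _ _ (single_mem_chainsOf trivial)

lemma boundary_mem_chainsOf {n : ℕ} {S : Set (SingularSimplex X (n + 1))}
    {S' : Set (SingularSimplex X n)} (h : ∀ σ ∈ S, ∀ i, σ.comp (coface i) ∈ S')
    {c : SingularChain R X (n + 1)} (hc : c ∈ chainsOf R S) :
    boundary R X n c ∈ chainsOf R S' :=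
  map_mem_of_mem_chainsOf _ _ (fun σ hσ => by
    rw [boundary_single]
    exact sum_mem fun i _ => Submodule.smul_mem _ _ (single_mem_chainsOf (h σ hσ i))) hc

end Chains

/-! ### Cones -/

/-- The point `t e₀ + (1 - t) x` of `Δⁿ⁺¹`, where `x` lies in the face opposite to `e₀`. -/
def joinPt {n : ℕ} (x : TopSimplex n) (t : unitInterval) : TopSimplex (n + 1) :=
  ⟨Fin.cons (t : ℝ) fun i => (1 - t : ℝ) * (x : Fin (n + 1) → ℝ) i, by
    refine ⟨fun j => ?_, ?_⟩
    · refine Fin.cases ?_ (fun i => ?_) j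
      · exact t.2.1
      · exact mul_nonneg (sub_nonneg.2 t.2.2) (x.2.1 i)
    · rw [Fin.sum_univ_succ]
      simp [← Finset.mul_sum]⟩

lemma joinPt_zero {n : ℕ} (x : TopSimplex n) (t : unitInterval) :
    (joinPt x t : Fin (n + 2) → ℝ) 0 = t := rfl

lemma joinPt_succ {n : ℕ} (x : TopSimplex n) (t : unitInterval) (i : Fin (n + 1)) :
    (joinPt x t : Fin (n + 2) → ℝ) i.succ = (1 - t) * (x : Fin (n + 1) → ℝ) i := rfl

lemma continuous_joinPt (n : ℕ) :
    Continuous fun p : TopSimplex n × unitInterval => joinPt p.1 p.2 := by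
  refine Continuous.subtype_mk (continuous_pi fun j => ?_) _
  refine Fin.cases ?_ (fun i => ?_) j
  · exact continuous_subtype_val.comp continuous_snd
  · have h1 : Continuous fun p : TopSimplex n × unitInterval => (p.2 : ℝ) :=
      continuous_subtype_val.comp continuous_snd
    have h2 : Continuous fun p : TopSimplex n × unitInterval => (p.1 : Fin (n + 1) → ℝ) i :=
      (continuous_apply i).comp (continuous_subtype_val.comp continuous_fst)
    exact (continuous_const.sub h1).mul h2

lemma exists_joinPt_eq {n : ℕ} (y : TopSimplex (n + 1)) : ∃ x t, joinPt x t = y := by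
  have hsum : y 0 + ∑ i : Fin (n + 1), y i.succ = 1 := by
    rw [← Fin.sum_univ_succ]
    exact y.2.2
  have hnn : ∀ i, 0 ≤ y i := y.2.1
  have hy0 : y 0 ≤ 1 := by
    have := Finset.sum_nonneg fun (i : Fin (n + 1)) (_ : i ∈ Finset.univ) => hnn i.succ
    linarith
  by_cases h : y 0 = 1
  · refine ⟨⟨Pi.single 0 1, single_mem_stdSimplex ℝ 0⟩, 1, ?_⟩
    ext j
    refine Fin.cases ?_ (fun i => ?_) j
    · exact h.symm
    · have h0 : ∑ i : Fin (n + 1), y i.succ = 0 := by linarith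
      have := (Finset.sum_eq_zero_iff_of_nonneg fun i _ => hnn (Fin.succ i)).1 h0 i
        (Finset.mem_univ i)
      simp [joinPt_succ, this]
  · have hpos : 0 < 1 - y 0 := sub_pos.2 (lt_of_le_of_ne hy0 h)
    refine ⟨⟨fun i => y i.succ / (1 - y 0),
      fun i => div_nonneg (hnn _) hpos.le, ?_⟩, ⟨y 0, hnn 0, hy0⟩, ?_⟩
    · rw [← Finset.sum_div, div_eq_one_iff_eq hpos.ne']
      linarith
    · ext j
      refine Fin.cases ?_ (fun i => ?_) j
      · rfl
      · rw [joinPt_succ]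
        exact mul_div_cancel₀ _ (ne_of_gt hpos)

/-- `joinPt` as a continuous map. -/
def joinMap (n : ℕ) : C(TopSimplex n × unitInterval, TopSimplex (n + 1)) where
  toFun p := joinPt p.1 p.2
  continuous_toFun := continuous_joinPt n

lemma isQuotientMap_joinMap (n : ℕ) : IsQuotientMap (joinMap n) :=
  (continuous_joinPt n).isClosedMap.isQuotientMap (continuous_joinPt n) fun y => by
    obtain ⟨x, t, h⟩ := exists_joinPt_eq y
    exact ⟨(x, t), h⟩

lemma joinPt_eq_joinPt {n : ℕ} {x x' : TopSimplex n} {t t' : unitInterval}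
    (h : joinPt x t = joinPt x' t') : t = t' ∧ (t = 1 ∨ x = x') := by
  have h0 : t = t' := Subtype.ext (congrFun (congrArg Subtype.val h) 0)
  subst h0
  refine ⟨rfl, or_iff_not_imp_left.2 fun ht => ?_⟩
  ext i
  have := DFunLike.congr_fun h i.succ
  rw [joinPt_succ, joinPt_succ] at this
  refine mul_left_cancel₀ (sub_ne_zero.2 fun h1 => ht ?_) this
  exact Subtype.ext h1.symm

lemma coface_zero_eq_joinPt {n : ℕ} (x : TopSimplex n) : coface 0 x = joinPt x 0 := by
  ext j
  change cofaceFun 0 _ j = _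
  refine Fin.cases ?_ (fun i => ?_) j
  · rw [cofaceFun_self, joinPt_zero]; rfl
  · rw [← Fin.zero_succAbove i, cofaceFun_succAbove, Fin.zero_succAbove, joinPt_succ]; simp

lemma coface_succ_joinPt {n : ℕ} (i : Fin (n + 2)) (x : TopSimplex n) (t : unitInterval) :
    coface i.succ (joinPt x t) = joinPt (coface i x) t := by
  ext j
  change cofaceFun i.succ _ j = _
  refine Fin.cases ?_ (fun l => ?_) j
  · conv_lhs => rw [← Fin.succ_succAbove_zero i, cofaceFun_succAbove]
    rfl
  · rw [joinPt_succ]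
    change _ = (1 - t : ℝ) * cofaceFun i _ l
    rcases Fin.eq_self_or_eq_succAbove i l with rfl | ⟨m, rfl⟩
    · rw [cofaceFun_self, cofaceFun_self, mul_zero]
    · rw [← Fin.succ_succAbove_succ, cofaceFun_succAbove, cofaceFun_succAbove, joinPt_succ]

/-- The data needed to cone off `σ` along the (not necessarily continuous) homotopy `G`:
`σ` lies in `D`, on which `G` is continuous along `σ` and contracts `σ` to a point. -/
structure Conable {X : Type*} [TopologicalSpace X] (G : X → unitInterval → X) (D : Set X)
    {n : ℕ} (σ : SingularSimplex X n) : Prop where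
  mem : ∀ x, σ x ∈ D
  cont : Continuous fun p : TopSimplex n × unitInterval => G (σ p.1) p.2
  const : ∀ x x', G (σ x) 1 = G (σ x') 1

section Cone

variable {X : Type*} [TopologicalSpace X] {G : X → unitInterval → X} {D : Set X} {n : ℕ}

lemma Conable.comp {m : ℕ} {σ : SingularSimplex X n} (h : Conable G D σ)
    (f : C(TopSimplex m, TopSimplex n)) : Conable G D (σ.comp f) where
  mem x := h.mem (f x)
  cont := h.cont.comp ((f.continuous.comp continuous_fst).prodMk continuous_snd)
  const x x' := h.const (f x) (f x')

lemma Conable.factorsThrough {σ : SingularSimplex X n} (h : Conable G D σ) :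
    Function.FactorsThrough (⟨_, h.cont⟩ : C(TopSimplex n × unitInterval, X)) (joinMap n) := by
  intro p q hpq
  obtain ⟨h0, h1⟩ := joinPt_eq_joinPt hpq
  rcases h1 with h1 | h1
  · have h2 : q.2 = 1 := h0 ▸ h1
    simpa [h1, h2] using h.const p.1 q.1
  · simp [h0, h1]

/-- The cone over a singular simplex. -/
def coneSimplex {σ : SingularSimplex X n} (h : Conable G D σ) : SingularSimplex X (n + 1) :=
  (isQuotientMap_joinMap n).lift ⟨_, h.cont⟩ h.factorsThrough

lemma coneSimplex_joinPt {σ : SingularSimplex X n} (h : Conable G D σ) (x : TopSimplex n)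
    (t : unitInterval) : coneSimplex h (joinPt x t) = G (σ x) t :=
  DFunLike.congr_fun ((isQuotientMap_joinMap n).lift_comp _ h.factorsThrough) (x, t)

lemma coneSimplex_comp_coface_zero (hG : ∀ x ∈ D, G x 0 = x) {σ : SingularSimplex X n}
    (h : Conable G D σ) : (coneSimplex h).comp (coface 0) = σ := by
  ext x
  simp only [ContinuousMap.comp_apply]
  rw [coface_zero_eq_joinPt, coneSimplex_joinPt, hG _ (h.mem x)]

lemma coneSimplex_comp_coface_succ {σ : SingularSimplex X (n + 1)}
    (h : Conable G D σ) (i : Fin (n + 2)) :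
    (coneSimplex h).comp (coface i.succ) = coneSimplex (h.comp (coface i)) := by
  ext y
  obtain ⟨x, t, rfl⟩ := exists_joinPt_eq y
  simp only [ContinuousMap.comp_apply]
  rw [coface_succ_joinPt, coneSimplex_joinPt, coneSimplex_joinPt]
  rfl

open Classical in
/-- The cone operator on chains; simplices which cannot be coned off are sent to zero. -/
def coneOp (R : Type*) [Ring R] (G : X → unitInterval → X) (D : Set X) (n : ℕ) :
    SingularChain R X n →ₗ[R] SingularChain R X (n + 1) :=
  Finsupp.lsum ℕ fun σ => LinearMap.toSpanSingleton R _
    (if h : Conable G D σ then Finsupp.single (coneSimplex h) 1 else 0)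

variable {R : Type*} [Ring R]

lemma coneOp_single {σ : SingularSimplex X n} (h : Conable G D σ) :
    coneOp R G D n (Finsupp.single σ 1) = Finsupp.single (coneSimplex h) 1 := by
  simp [coneOp, h]

lemma coneOp_single_of_not {σ : SingularSimplex X n} (h : ¬ Conable G D σ) :
    coneOp R G D n (Finsupp.single σ 1) = 0 := by
  simp [coneOp, h]

lemma boundary_coneOp_single (hG : ∀ x ∈ D, G x 0 = x) {σ : SingularSimplex X (n + 1)}
    (h : Conable G D σ) :
    boundary R X (n + 1) (coneOp R G D (n + 1) (Finsupp.single σ 1)) =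
      Finsupp.single σ 1 - coneOp R G D n (boundary R X n (Finsupp.single σ 1)) := by
  rw [coneOp_single h, boundary_single, boundary_single, Fin.sum_univ_succ,
    coneSimplex_comp_coface_zero hG h, map_sum]
  simp only [map_smul, coneSimplex_comp_coface_succ, coneOp_single (h.comp _), Fin.val_succ,
    Fin.val_zero, pow_zero, one_smul, pow_succ, mul_neg, mul_one, neg_smul,
    Finset.sum_neg_distrib, sub_eq_add_neg]

lemma coneOp_mem_chainsOf {S : Set (SingularSimplex X n)} {S' : Set (SingularSimplex X (n + 1))}
    (hS : ∀ σ ∈ S, ∀ h : Conable G D σ, coneSimplex h ∈ S') {c : SingularChain R X n}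
    (hc : c ∈ chainsOf R S) : coneOp R G D n c ∈ chainsOf R S' :=
  map_mem_of_mem_chainsOf _ _ (fun σ hσ => by
    by_cases h : Conable G D σ
    · rw [coneOp_single h]
      exact single_mem_chainsOf (hS σ hσ h)
    · rw [coneOp_single_of_not h]
      exact zero_mem _) hc

end Cone

/-! ### Affine simplices -/

/-- A map of standard simplices which is the restriction of a linear map. -/
def IsAffine {n m : ℕ} (τ : C(TopSimplex n, TopSimplex m)) : Prop :=
  ∃ L : (Fin (n + 1) → ℝ) →ₗ[ℝ] (Fin (m + 1) → ℝ), ∀ x : TopSimplex n, (τ x).1 = L x.1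

lemma IsAffine.id (n : ℕ) : IsAffine (ContinuousMap.id (TopSimplex n)) :=
  ⟨LinearMap.id, fun _ => rfl⟩

lemma IsAffine.comp {n m k : ℕ} {τ : C(TopSimplex m, TopSimplex k)}
    {ρ : C(TopSimplex n, TopSimplex m)} (hτ : IsAffine τ) (hρ : IsAffine ρ) :
    IsAffine (τ.comp ρ) := by
  obtain ⟨L, hL⟩ := hτ
  obtain ⟨M, hM⟩ := hρ
  exact ⟨L ∘ₗ M, fun x => by simp [hL, hM]⟩

/-- The linear extension of a coface map. -/
def cofaceLinear {n : ℕ} (i : Fin (n + 2)) : (Fin (n + 1) → ℝ) →ₗ[ℝ] (Fin (n + 2) → ℝ) where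
  toFun := cofaceFun i
  map_add' x y := by
    ext j
    simp only [cofaceFun, Pi.add_apply, ← Finset.sum_add_distrib]
    exact Finset.sum_congr rfl fun k _ => by split_ifs <;> simp
  map_smul' r x := by
    ext j
    simp [cofaceFun, Finset.mul_sum]

lemma IsAffine.coface {n : ℕ} (i : Fin (n + 2)) : IsAffine (coface i) :=
  ⟨cofaceLinear i, fun _ => rfl⟩

lemma IsAffine.exists_preimage_faceSet_eq {n m : ℕ} {ρ : C(TopSimplex n, TopSimplex m)}
    (hρ : IsAffine ρ) (S : Finset (Fin (m + 1))) : ∃ T, ρ ⁻¹' faceSet m S = faceSet n T := by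
  classical
  obtain ⟨L, hL⟩ := hρ
  let e : Fin (n + 1) → TopSimplex n := fun i => ⟨Pi.single i 1, single_mem_stdSimplex ℝ i⟩
  have key : ∀ (x : TopSimplex n) j, (ρ x).1 j = ∑ i, x.1 i * (ρ (e i)).1 j := by
    intro x j
    rw [hL, LinearMap.pi_apply_eq_sum_univ L x.1, Finset.sum_apply]
    refine Finset.sum_congr rfl fun i _ => ?_
    have he : (fun k => if i = k then (1 : ℝ) else 0) = (e i).1 := by
      ext k
      simp [e, Pi.single_apply, eq_comm]
    rw [hL, Pi.smul_apply, smul_eq_mul, he]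
  refine ⟨Finset.univ.filter fun i => ρ (e i) ∈ faceSet m S, ?_⟩
  ext x
  constructor
  · intro hx i hi
    by_contra hxi
    refine hi (Finset.mem_filter.2 ⟨Finset.mem_univ _, fun j hj => ?_⟩)
    have h0 : ∑ i, x.1 i * (ρ (e i)).1 j = 0 := (key x j).symm.trans (hx j hj)
    have := (Finset.sum_eq_zero_iff_of_nonneg fun i _ =>
      mul_nonneg (x.2.1 i) ((ρ (e i)).2.1 j)).1 h0 i (Finset.mem_univ i)
    exact (mul_eq_zero.1 this).resolve_left hxi
  · intro hx j hj
    refine (key x j).trans (Finset.sum_eq_zero fun i _ => ?_)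
    by_cases hi : ρ (e i) ∈ faceSet m S
    · exact mul_eq_zero_of_right _ (hi j hj)
    · exact mul_eq_zero_of_left (hx i fun h => hi (Finset.mem_filter.1 h).2) _

lemma Admissible.comp {X : Type*} [TopologicalSpace X] {B : Set X} {n m : ℕ}
    {σ : SingularSimplex X m} (hσ : Admissible B σ) {ρ : C(TopSimplex n, TopSimplex m)}
    (hρ : IsAffine ρ) : Admissible B (σ.comp ρ) := by
  obtain ⟨𝒮, h𝒮⟩ := hσ
  choose f hf using hρ.exists_preimage_faceSet_eq
  refine ⟨f '' 𝒮, ?_⟩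
  rw [ContinuousMap.coe_comp, Set.preimage_comp, h𝒮]
  simp only [Set.preimage_iUnion, hf, Set.biUnion_image]

/-- The straight-line homotopy from the identity of `Δⁿ` to the constant map at `p`. -/
def segPt {n : ℕ} (p x : TopSimplex n) (t : unitInterval) : TopSimplex n :=
  ⟨(1 - t : ℝ) • x.1 + (t : ℝ) • p.1, convex_stdSimplex ℝ _ x.2 p.2
    (sub_nonneg.2 t.2.2) t.2.1 (sub_add_cancel _ _)⟩

lemma segPt_zero {n : ℕ} (p x : TopSimplex n) : segPt p x 0 = x :=
  Subtype.ext (by simp [segPt])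

lemma conable_segPt {n m : ℕ} (p : TopSimplex n) (σ : SingularSimplex (TopSimplex n) m) :
    Conable (segPt p) Set.univ σ where
  mem _ := trivial
  cont := by
    have h1 : Continuous fun q : TopSimplex m × unitInterval => (q.2 : ℝ) :=
      continuous_subtype_val.comp continuous_snd
    have h2 : Continuous fun q : TopSimplex m × unitInterval => (σ q.1).1 :=
      continuous_subtype_val.comp (σ.continuous.comp continuous_fst)
    exact Continuous.subtype_mk
      (((continuous_const.sub h1).smul h2).add (h1.smul continuous_const)) _
  const x x' := Subtype.ext (by simp [segPt])

lemma IsAffine.coneSimplex {n m : ℕ} {p : TopSimplex n} {σ : SingularSimplex (TopSimplex n) m}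
    (hσ : IsAffine σ) (h : Conable (segPt p) Set.univ σ) : IsAffine (coneSimplex h) := by
  obtain ⟨L, hL⟩ := hσ
  refine ⟨L ∘ₗ LinearMap.funLeft ℝ ℝ Fin.succ + (LinearMap.proj 0).smulRight p.1, fun y => ?_⟩
  obtain ⟨x, t, rfl⟩ := exists_joinPt_eq y
  rw [coneSimplex_joinPt]
  have h1 : LinearMap.funLeft ℝ ℝ Fin.succ (joinPt x t).1 = (1 - t : ℝ) • x.1 := rfl
  have h2 : (joinPt x t).1 0 = t := rfl
  simp [h1, h2, segPt, hL]

/-! ### Barycentric subdivision -/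

/-- The barycentre of `Δⁿ`. -/
def bary (n : ℕ) : TopSimplex n :=
  ⟨fun _ => ((n : ℝ) + 1)⁻¹, fun _ => by positivity, by
    simp only [Finset.sum_const, Finset.card_univ, Fintype.card_fin, nsmul_eq_mul]
    push_cast
    exact mul_inv_cancel₀ (by positivity)⟩

section Subdivision

variable {R : Type*} [Ring R] {X Y : Type*} [TopologicalSpace X] [TopologicalSpace Y]

/-- The natural operator on singular chains sending the universal `n`-simplex to `u`. -/
def natOp {n m : ℕ} (u : SingularChain R (TopSimplex n) m) :
    SingularChain R X n →ₗ[R] SingularChain R X m :=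
  Finsupp.lsum ℕ fun σ => LinearMap.toSpanSingleton R _ (pushChain R σ m u)

lemma natOp_single {n m : ℕ} (u : SingularChain R (TopSimplex n) m) (σ : SingularSimplex X n) :
    natOp u (Finsupp.single σ 1) = pushChain R σ m u := by
  simp [natOp]

lemma pushChain_pushChain {Z : Type*} [TopologicalSpace Z] (f : C(Y, Z)) (g : C(X, Y)) (n : ℕ)
    (c : SingularChain R X n) :
    pushChain R f n (pushChain R g n c) = pushChain R (f.comp g) n c := by
  suffices h : pushChain R f n ∘ₗ pushChain R g n = pushChain R (f.comp g) n from
    LinearMap.congr_fun h c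
  refine chain_hom_ext fun σ => ?_
  simp [pushChain_single, ContinuousMap.comp_assoc]

lemma natOp_pushChain {n m : ℕ} (u : SingularChain R (TopSimplex n) m) (f : C(X, Y))
    (c : SingularChain R X n) :
    natOp u (pushChain R f n c) = pushChain R f m (natOp u c) := by
  suffices h : natOp u ∘ₗ pushChain R f n = pushChain R f m ∘ₗ natOp u from
    LinearMap.congr_fun h c
  refine chain_hom_ext fun σ => ?_
  simp [pushChain_single, natOp_single, pushChain_pushChain]

lemma pushChain_single_id {n : ℕ} (σ : SingularSimplex X n) :
    pushChain R σ n (Finsupp.single (ContinuousMap.id (TopSimplex n)) 1) =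
      Finsupp.single σ 1 := by
  rw [pushChain_single, ContinuousMap.comp_id]

lemma natOp_mem_chainsOf {n m : ℕ} {P : Set (SingularSimplex (TopSimplex n) m)}
    {u : SingularChain R (TopSimplex n) m} (hu : u ∈ chainsOf R P)
    {S : Set (SingularSimplex X n)} {S' : Set (SingularSimplex X m)}
    (h : ∀ σ ∈ S, ∀ ρ ∈ P, σ.comp ρ ∈ S') {c : SingularChain R X n} (hc : c ∈ chainsOf R S) :
    natOp u c ∈ chainsOf R S' :=
  map_mem_of_mem_chainsOf _ _ (fun σ hσ => by
    rw [natOp_single]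
    exact pushChain_mem_chainsOf σ (h σ hσ) hu) hc

/-- Coning off chains in `Δⁿ` at the barycentre. -/
abbrev baryCone (R : Type*) [Ring R] (n m : ℕ) :
    SingularChain R (TopSimplex n) m →ₗ[R] SingularChain R (TopSimplex n) (m + 1) :=
  coneOp R (segPt (bary n)) Set.univ m

lemma boundary_baryCone (n m : ℕ) (c : SingularChain R (TopSimplex n) (m + 1)) :
    boundary R _ (m + 1) (baryCone R n (m + 1) c) =
      c - baryCone R n m (boundary R _ m c) := by
  suffices h : boundary R _ (m + 1) ∘ₗ baryCone R n (m + 1) =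
      LinearMap.id - baryCone R n m ∘ₗ boundary R _ m from LinearMap.congr_fun h c
  exact chain_hom_ext fun σ =>
    boundary_coneOp_single (fun x _ => segPt_zero _ x) (conable_segPt _ σ)

/-- The universal `n`-simplex as a chain. -/
abbrev universalChain (R : Type*) [Ring R] (n : ℕ) : SingularChain R (TopSimplex n) n :=
  Finsupp.single (ContinuousMap.id (TopSimplex n)) 1

/-- The barycentric subdivision of the universal `n`-simplex. -/
def subdivChain (R : Type*) [Ring R] : (n : ℕ) → SingularChain R (TopSimplex n) n
  | 0 => universalChain R 0
  | n + 1 => baryCone R (n + 1) n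
      (natOp (subdivChain R n) (boundary R _ n (universalChain R (n + 1))))

/-- The universal chain homotopy from the identity to barycentric subdivision. -/
def subdivHomotopyChain (R : Type*) [Ring R] : (n : ℕ) → SingularChain R (TopSimplex n) (n + 1)
  | 0 => 0
  | n + 1 => baryCone R (n + 1) (n + 1) (universalChain R (n + 1) -
      natOp (subdivHomotopyChain R n) (boundary R _ n (universalChain R (n + 1))))

/-- Barycentric subdivision. -/
abbrev subdiv (R : Type*) [Ring R] (X : Type*) [TopologicalSpace X] (n : ℕ) :
    SingularChain R X n →ₗ[R] SingularChain R X n :=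
  natOp (subdivChain R n)

/-- The chain homotopy from the identity to barycentric subdivision. -/
abbrev subdivHomotopy (R : Type*) [Ring R] (X : Type*) [TopologicalSpace X] (n : ℕ) :
    SingularChain R X n →ₗ[R] SingularChain R X (n + 1) :=
  natOp (subdivHomotopyChain R n)

lemma subdiv_zero (c : SingularChain R X 0) : subdiv R X 0 c = c := by
  suffices h : subdiv R X 0 = LinearMap.id from LinearMap.congr_fun h c
  refine chain_hom_ext fun σ => ?_
  rw [natOp_single, subdivChain, pushChain_single_id, LinearMap.id_apply]

lemma subdivHomotopy_zero (c : SingularChain R X 0) : subdivHomotopy R X 0 c = 0 := by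
  suffices h : subdivHomotopy R X 0 = 0 from LinearMap.congr_fun h c
  refine chain_hom_ext fun σ => ?_
  rw [natOp_single, subdivHomotopyChain, map_zero, LinearMap.zero_apply]

/-- It suffices to check the homotopy formula on the universal simplex. -/
lemma boundary_subdivHomotopy_of_universal {n : ℕ}
    (h : boundary R _ (n + 1) (subdivHomotopyChain R (n + 1)) = universalChain R (n + 1) -
      subdivHomotopy R _ n (boundary R _ n (universalChain R (n + 1))) - subdivChain R (n + 1))
    (c : SingularChain R X (n + 1)) :
    boundary R X (n + 1) (subdivHomotopy R X (n + 1) c) =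
      c - subdivHomotopy R X n (boundary R X n c) - subdiv R X (n + 1) c := by
  suffices H : boundary R X (n + 1) ∘ₗ subdivHomotopy R X (n + 1) =
      LinearMap.id - subdivHomotopy R X n ∘ₗ boundary R X n - subdiv R X (n + 1) from
    LinearMap.congr_fun H c
  refine chain_hom_ext fun σ => ?_
  simp only [LinearMap.comp_apply, LinearMap.sub_apply, LinearMap.id_apply]
  rw [natOp_single, boundary_pushChain, h, map_sub, map_sub, pushChain_single_id,
    ← natOp_pushChain, ← boundary_pushChain, pushChain_single_id, natOp_single (subdivChain R _)]

lemma boundary_subdivHomotopyChain (n : ℕ) :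
    boundary R _ (n + 1) (subdivHomotopyChain R (n + 1)) = universalChain R (n + 1) -
      subdivHomotopy R _ n (boundary R _ n (universalChain R (n + 1))) -
      subdivChain R (n + 1) := by
  have key : boundary R _ n (subdivHomotopy R _ n (boundary R _ n (universalChain R (n + 1)))) =
      boundary R _ n (universalChain R (n + 1)) -
        subdiv R _ n (boundary R _ n (universalChain R (n + 1))) := by
    cases n with
    | zero => rw [subdivHomotopy_zero, subdiv_zero, map_zero, sub_self]
    | succ n =>
      rw [boundary_subdivHomotopy_of_universal (boundary_subdivHomotopyChain n),
        boundary_boundary, map_zero, sub_zero]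
  rw [subdivHomotopyChain, boundary_baryCone, map_sub, key, sub_sub_cancel]
  rfl

lemma boundary_subdivHomotopy {n : ℕ} (c : SingularChain R X (n + 1)) :
    boundary R X (n + 1) (subdivHomotopy R X (n + 1) c) =
      c - subdivHomotopy R X n (boundary R X n c) - subdiv R X (n + 1) c :=
  boundary_subdivHomotopy_of_universal (boundary_subdivHomotopyChain n) c

lemma boundary_subdiv {n : ℕ} (c : SingularChain R X (n + 1)) :
    boundary R X n (subdiv R X (n + 1) c) = subdiv R X n (boundary R X n c) := by
  have h : subdiv R X (n + 1) c = c - subdivHomotopy R X n (boundary R X n c) -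
      boundary R X (n + 1) (subdivHomotopy R X (n + 1) c) := by
    rw [boundary_subdivHomotopy, sub_sub_cancel]
  rw [h, map_sub, map_sub, boundary_boundary, sub_zero]
  cases n with
  | zero => rw [subdivHomotopy_zero, subdiv_zero, map_zero, sub_zero]
  | succ n => rw [boundary_subdivHomotopy, boundary_boundary, map_zero, sub_zero, sub_sub_cancel]

lemma boundary_universalChain_mem (n : ℕ) : boundary R _ n (universalChain R (n + 1)) ∈
    chainsOf R (Set.range (coface (n := n))) :=
  boundary_mem_chainsOf (S := {ContinuousMap.id _}) (S' := Set.range coface)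
    (fun σ hσ i => ⟨i, by rw [Set.mem_singleton_iff.1 hσ, ContinuousMap.id_comp]⟩)
    (single_mem_chainsOf rfl)

lemma subdivHomotopyChain_mem (n : ℕ) :
    subdivHomotopyChain R n ∈ chainsOf R {ρ | IsAffine ρ} := by
  induction n with
  | zero => exact zero_mem _
  | succ n ih =>
    refine coneOp_mem_chainsOf (S := {ρ | IsAffine ρ}) (fun σ hσ h => hσ.coneSimplex h)
      (sub_mem (single_mem_chainsOf (IsAffine.id _)) ?_)
    refine natOp_mem_chainsOf ih ?_ (boundary_universalChain_mem n)
    rintro _ ⟨i, rfl⟩ ρ hρ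
    exact (IsAffine.coface i).comp hρ

/-- Affine self-maps of `Δⁿ` which shrink diameters, measured after any linear map, by the
factor `n / (n + 1)`. -/
def shrinking (n : ℕ) : Set (SingularSimplex (TopSimplex n) n) :=
  {ρ | IsAffine ρ ∧ ∀ (k : ℕ) (L : (Fin (n + 1) → ℝ) →ₗ[ℝ] (Fin k → ℝ)) (d : ℝ),
    (∀ x y : TopSimplex n, ‖L x.1 - L y.1‖ ≤ d) →
    ∀ x y : TopSimplex n, ‖L (ρ x).1 - L (ρ y).1‖ ≤ (n / (n + 1) : ℝ) * d}

lemma norm_sub_bary_le {n k : ℕ} {L : (Fin (n + 2) → ℝ) →ₗ[ℝ] (Fin k → ℝ)} {d : ℝ}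
    (h : ∀ x y : TopSimplex (n + 1), ‖L x.1 - L y.1‖ ≤ d) (y : TopSimplex (n + 1)) :
    ‖L y.1 - L (bary (n + 1)).1‖ ≤ ((n + 1 : ℝ) / (n + 2)) * d := by
  have hy1 : ∀ i, y.1 i ≤ 1 := fun i =>
    (Finset.single_le_sum (fun j _ => y.2.1 j) (Finset.mem_univ i)).trans y.2.2.le
  let z : TopSimplex (n + 1) := ⟨fun i => (1 - y.1 i) / (n + 1), fun i =>
    div_nonneg (sub_nonneg.2 (hy1 i)) (by positivity), by
      rw [← Finset.sum_div, Finset.sum_sub_distrib, y.2.2]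
      simp only [Finset.sum_const, Finset.card_univ, Fintype.card_fin, nsmul_eq_mul]
      push_cast
      field_simp
      ring⟩
  have hz : y.1 - (bary (n + 1)).1 = ((n + 1 : ℝ) / (n + 2)) • (y.1 - z.1) := by
    ext i
    simp only [Pi.sub_apply, Pi.smul_apply, smul_eq_mul, bary, z]
    push_cast
    field_simp
    ring
  rw [← map_sub, hz, map_smul, norm_smul, map_sub, Real.norm_of_nonneg (by positivity)]
  exact mul_le_mul_of_nonneg_left (h y z) (by positivity)

lemma subdivChain_mem (n : ℕ) : subdivChain R n ∈ chainsOf R (shrinking n) := by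
  induction n with
  | zero =>
    refine single_mem_chainsOf ⟨IsAffine.id _, fun k L d _ x y => ?_⟩
    have : x = y := Subsingleton.elim _ _
    simp [this]
  | succ n ih =>
    refine coneOp_mem_chainsOf (S := {σ | ∃ i, ∃ ρ ∈ shrinking n, σ = (coface i).comp ρ}) ?_
      (natOp_mem_chainsOf ih ?_ (boundary_universalChain_mem n))
    · rintro _ ⟨i, ρ, ⟨hρ, hshr⟩, rfl⟩ h
      refine ⟨((IsAffine.coface i).comp hρ).coneSimplex h, fun k L d hd x y => ?_⟩
      obtain ⟨x, s, rfl⟩ := exists_joinPt_eq x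
      obtain ⟨y, t, rfl⟩ := exists_joinPt_eq y
      rw [coneSimplex_joinPt, coneSimplex_joinPt]
      set p := L (bary (n + 1)).1 with hp
      set u : TopSimplex n → (Fin k → ℝ) := fun x => L (coface i (ρ x)).1 with hu
      have hseg : ∀ x s, L (segPt (bary (n + 1)) ((coface i).comp ρ x) s).1 =
          (1 - s : ℝ) • u x + (s : ℝ) • p := fun x s => by
        simp [segPt, hu, hp]
      rw [hseg, hseg]
      push_cast
      have hd0 : 0 ≤ d := (norm_nonneg _).trans (hd (bary _) (bary _))
      set d' := ((n : ℝ) + 1) / (n + 1 + 1) * d with hd'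
      have hd'0 : 0 ≤ d' := by positivity
      have huu : ∀ x y, u x ∈ Metric.closedBall (u y) d' := fun x y => by
        rw [mem_closedBall_iff_norm]
        refine (hshr k (L ∘ₗ cofaceLinear i) d (fun a b => hd (coface i a) (coface i b)) x y).trans
          (mul_le_mul_of_nonneg_right ?_ hd0)
        rw [div_le_div_iff₀ (by positivity) (by positivity)]
        nlinarith
      have hup : ∀ x, u x ∈ Metric.closedBall p d' := fun x => by
        rw [mem_closedBall_iff_norm]
        refine (norm_sub_bary_le hd (coface i (ρ x))).trans (le_of_eq ?_)
        rw [hd']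
        ring
      have hmem : ∀ c, (∀ x, u x ∈ Metric.closedBall c d') → p ∈ Metric.closedBall c d' →
          ∀ x (s : unitInterval), (1 - s : ℝ) • u x + (s : ℝ) • p ∈ Metric.closedBall c d' :=
        fun c h1 h2 x s => convex_closedBall c d' (h1 x) h2 (sub_nonneg.2 s.2.2) s.2.1
          (sub_add_cancel _ _)
      rw [← mem_closedBall_iff_norm]
      refine hmem _ (fun z => Metric.mem_closedBall_comm.1 ?_)
        (Metric.mem_closedBall_comm.1 ?_) x s
      · exact hmem _ (fun w => huu w z) (Metric.mem_closedBall_comm.1 (hup z)) y t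
      · exact hmem _ hup (Metric.mem_closedBall_self hd'0) y t
    · rintro _ ⟨i, rfl⟩ ρ hρ
      exact ⟨i, ρ, hρ, rfl⟩

lemma subdiv_pow_single_mem {n : ℕ} (σ : SingularSimplex X n) (N : ℕ) :
    (subdiv R X n ^ N) (Finsupp.single σ 1) ∈ chainsOf R {ρ | ∃ τ : C(TopSimplex n, TopSimplex n),
      (IsAffine τ ∧ ∀ x y, ‖(τ x).1 - (τ y).1‖ ≤ (n / (n + 1) : ℝ) ^ N) ∧ ρ = σ.comp τ} := by
  induction N with
  | zero =>
    refine single_mem_chainsOf ⟨ContinuousMap.id _, ⟨IsAffine.id n, fun x y => ?_⟩, rfl⟩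
    rw [pow_zero, pi_norm_le_iff_of_nonneg zero_le_one]
    intro i
    have h : ∀ z : TopSimplex n, 0 ≤ z.1 i ∧ z.1 i ≤ 1 := fun z => ⟨z.2.1 i,
      (Finset.single_le_sum (fun j _ => z.2.1 j) (Finset.mem_univ i)).trans z.2.2.le⟩
    simp only [ContinuousMap.id_apply, Pi.sub_apply]
    exact abs_sub_le_iff.2 ⟨by linarith [(h x).2, (h y).1], by linarith [(h y).2, (h x).1]⟩
  | succ N ih =>
    rw [pow_succ' (subdiv R X n), Module.End.mul_apply]
    refine natOp_mem_chainsOf (subdivChain_mem n) ?_ ih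
    rintro _ ⟨τ, ⟨hτ, hdiam⟩, rfl⟩ ρ ⟨hρ, hshr⟩
    refine ⟨τ.comp ρ, ⟨hτ.comp hρ, fun x y => ?_⟩, rfl⟩
    obtain ⟨L, hL⟩ := hτ
    rw [pow_succ']
    simp only [ContinuousMap.comp_apply]
    rw [hL, hL]
    exact hshr _ L _ (fun a b => by rw [← hL, ← hL]; exact hdiam a b) x y

/-- Singular simplices contained in a member of the family `U`. -/
def smallSimplices {ι : Type*} (U : ι → Set X) (n : ℕ) : Set (SingularSimplex X n) :=
  {σ | ∃ i, ∀ x, σ x ∈ U i}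

lemma subdiv_pow_mem_small {ι : Type*} (U : ι → Set X) {n : ℕ} {c : SingularChain R X n}
    (hc : c ∈ chainsOf R (smallSimplices U n)) (N : ℕ) :
    (subdiv R X n ^ N) c ∈ chainsOf R (smallSimplices U n) := by
  induction N with
  | zero => exact hc
  | succ N ih =>
    rw [pow_succ', Module.End.mul_apply]
    refine natOp_mem_chainsOf (subdivChain_mem n) ?_ ih
    rintro σ ⟨i, hi⟩ ρ -
    exact ⟨i, fun x => hi (ρ x)⟩

lemma exists_subdiv_pow_mem_small {ι : Type*} {U : ι → Set X} (hU : ∀ i, IsOpen (U i))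
    (hcover : ∀ x, ∃ i, x ∈ U i) {n : ℕ} (c : SingularChain R X n) :
    ∃ N, (subdiv R X n ^ N) c ∈ chainsOf R (smallSimplices U n) := by
  induction c using Finsupp.induction_linear with
  | zero => exact ⟨0, zero_mem _⟩
  | add f g hf hg =>
    obtain ⟨N, hN⟩ := hf
    obtain ⟨M, hM⟩ := hg
    refine ⟨N + M, ?_⟩
    rw [map_add]
    refine add_mem ?_ ?_
    · rw [add_comm, pow_add, Module.End.mul_apply]
      exact subdiv_pow_mem_small U hN M
    · rw [pow_add, Module.End.mul_apply]
      exact subdiv_pow_mem_small U hM N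
  | single σ r =>
    obtain ⟨δ, hδ, hball⟩ := lebesgue_number_lemma_of_metric
      (isCompact_univ (X := TopSimplex n)) (c := fun i => σ ⁻¹' U i)
      (fun i => (hU i).preimage σ.continuous)
      (fun x _ => Set.mem_iUnion.2 (hcover (σ x)))
    obtain ⟨N, hN⟩ := exists_pow_lt_of_lt_one hδ
      (show ((n : ℝ) / (n + 1)) < 1 by rw [div_lt_one (by positivity)]; linarith)
    refine ⟨N, ?_⟩
    rw [← mul_one r, ← smul_eq_mul, ← Finsupp.smul_single, map_smul]
    refine Submodule.smul_mem _ _ (Submodule.span_mono ?_ (subdiv_pow_single_mem σ N))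
    rintro _ ⟨_, ⟨τ, ⟨-, hdiam⟩, rfl⟩, rfl⟩
    obtain ⟨i, hi⟩ := hball (τ (bary n)) trivial
    refine ⟨σ.comp τ, ⟨i, fun x => hi ?_⟩, rfl⟩
    rw [Metric.mem_ball, Subtype.dist_eq, dist_eq_norm]
    exact (hdiam x (bary n)).trans_lt hN

end Subdivision

/-! ### Marked spaces -/

section Marked

variable {R : Type*} [Ring R] {X : Type*} [TopologicalSpace X] {B : Set X}

lemma admissible_coneSimplex {G : X → unitInterval → X} {D : Set X} {n : ℕ}
    (hG : ∀ x ∈ D, ∀ t, G x t ∈ B ↔ x ∈ B ∨ t = 1) {σ : SingularSimplex X n}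
    (hσ : Admissible B σ) (h : Conable G D σ) : Admissible B (coneSimplex h) := by
  obtain ⟨𝒮, h𝒮⟩ := hσ
  refine ⟨insert {0} ((fun S => insert 0 (S.map (Fin.succEmb _))) '' 𝒮), ?_⟩
  ext y
  obtain ⟨x, t, rfl⟩ := exists_joinPt_eq y
  have hx : σ x ∈ B ↔ ∃ S ∈ 𝒮, x ∈ faceSet n S := by
    simpa using Set.ext_iff.1 h𝒮 x
  have ht : t = 1 ↔ (1 - t : ℝ) = 0 := by
    rw [sub_eq_zero, eq_comm, ← Subtype.val_inj]
    rfl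
  have h0 : joinPt x t ∈ faceSet (n + 1) {0} ↔ t = 1 := by
    constructor
    · intro hy
      have hsum := (joinPt x t).2.2
      rw [Fin.sum_univ_succ, Finset.sum_eq_zero fun i _ => hy i.succ (by simp), add_zero] at hsum
      exact Subtype.ext hsum
    · intro h1 j hj
      obtain ⟨i, rfl⟩ := Fin.exists_succ_eq.2 (by simpa using hj : j ≠ 0)
      exact mul_eq_zero_of_left (ht.1 h1) _
  have hS : ∀ S : Finset (Fin (n + 1)),
      joinPt x t ∈ faceSet (n + 1) (insert 0 (S.map (Fin.succEmb _))) ↔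
        t = 1 ∨ x ∈ faceSet n S := by
    intro S
    constructor
    · intro hy
      refine or_iff_not_imp_left.2 fun h1 j hj => ?_
      exact (mul_eq_zero.1 (hy j.succ (by simpa using hj))).resolve_left (mt ht.2 h1)
    · intro hor j hj
      obtain ⟨i, rfl⟩ := Fin.exists_succ_eq.2 (fun h' : j = 0 => hj (by simp [h']))
      rcases hor with h1 | h1
      · exact mul_eq_zero_of_left (ht.1 h1) _
      · exact mul_eq_zero_of_right _ (h1 i (by simpa using hj))
  rw [Set.mem_preimage, coneSimplex_joinPt, hG _ (h.mem x), hx]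
  simp only [Set.mem_iUnion, Set.mem_insert_iff, Set.mem_image, exists_prop,
    exists_eq_or_imp, h0, exists_exists_and_eq_and, hS]
  constructor
  · rintro (⟨S, hS, hxS⟩ | h1)
    exacts [Or.inr ⟨S, hS, Or.inr hxS⟩, Or.inl h1]
  · rintro (h1 | ⟨S, hS, h1 | hxS⟩)
    exacts [Or.inr h1, Or.inr h1, Or.inl ⟨S, hS, hxS⟩]

lemma admissible_of_forall_mem {n : ℕ} {σ : SingularSimplex X n} (h : ∀ x, σ x ∈ B) :
    Admissible B σ := by
  refine ⟨{Finset.univ}, ?_⟩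
  ext x
  simp [faceSet, h]

lemma admissible_of_forall_notMem {n : ℕ} {σ : SingularSimplex X n} (h : ∀ x, σ x ∉ B) :
    Admissible B σ := by
  refine ⟨∅, ?_⟩
  ext x
  simp [h]

lemma admissible_zero (σ : SingularSimplex X 0) : Admissible B σ := by
  by_cases h : σ (bary 0) ∈ B
  · exact admissible_of_forall_mem fun x => Subsingleton.elim (bary 0) x ▸ h
  · exact admissible_of_forall_notMem fun x => Subsingleton.elim (bary 0) x ▸ h

lemma boundary_mem_admissibleChains {n : ℕ} {c : SingularChain R X (n + 1)}
    (hc : c ∈ admissibleChains R X B (n + 1)) : boundary R X n c ∈ admissibleChains R X B n :=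
  boundary_mem_chainsOf (S := {σ | Admissible B σ}) (S' := {σ | Admissible B σ})
    (fun _ hσ i => hσ.comp (IsAffine.coface i)) hc

lemma chainsIn_le_admissibleChains (n : ℕ) : chainsIn R X B n ≤ admissibleChains R X B n := by
  refine Submodule.span_mono ?_
  rintro _ ⟨σ, hσ, rfl⟩
  exact ⟨σ, admissible_of_forall_mem fun x => hσ ⟨x, rfl⟩, rfl⟩

lemma admissibleChains_zero : admissibleChains R X B 0 = ⊤ := by
  rw [← chainsOf_univ]
  simp [admissibleChains, chainsOf, admissible_zero]

lemma subdiv_mem_admissibleChains {n : ℕ} {c : SingularChain R X n}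
    (hc : c ∈ admissibleChains R X B n) : subdiv R X n c ∈ admissibleChains R X B n :=
  natOp_mem_chainsOf (S := {σ | Admissible B σ}) (S' := {σ | Admissible B σ}) (subdivChain_mem n)
    (fun _ hσ _ hρ => hσ.comp hρ.1) hc

lemma subdivHomotopy_mem_admissibleChains {n : ℕ} {c : SingularChain R X n}
    (hc : c ∈ admissibleChains R X B n) :
    subdivHomotopy R X n c ∈ admissibleChains R X B (n + 1) :=
  natOp_mem_chainsOf (S := {σ | Admissible B σ}) (S' := {σ | Admissible B σ})
    (subdivHomotopyChain_mem n) (fun _ hσ _ hρ => hσ.comp hρ) hc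

/-- The contractions of the quasicones of a marked space, glued to one homotopy `G` on their
union `D`, together with an open cover by the complement of `B` and sets contracted by `G`. -/
lemma IsMarkedSpace.exists_contraction (hXB : IsMarkedSpace X B) :
    ∃ (G : X → unitInterval → X) (D : Set X) (U : Option B → Set X),
      (∀ i, IsOpen (U i)) ∧ (∀ x, ∃ i, x ∈ U i) ∧ U none = Bᶜ ∧
      (∀ x ∈ D, G x 0 = x) ∧ (∀ x ∈ D, ∀ t, G x t ∈ B ↔ x ∈ B ∨ t = 1) ∧
      ∀ (b : B) (n : ℕ) (σ : SingularSimplex X n), (∀ x, σ x ∈ U (some b)) → Conable G D σ := by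
  classical
  obtain ⟨hB, F, -, hnhds, hdisj, hF⟩ := hXB
  choose hb H H0 H1 Hb using hF
  have huniq : ∀ {x : X} {b b' : B}, x ∈ F b → x ∈ F b' → b = b' := fun {x b b'} h h' => by
    by_contra hne
    exact Set.disjoint_left.1 (hdisj b b' hne) h h'
  have hmemB : ∀ {b : B} {x : X}, x ∈ F b → (x ∈ B ↔ x = b) := fun {b x} hx =>
    ⟨fun hxB => congrArg Subtype.val (huniq (hb ⟨x, hxB⟩) hx), fun h => h ▸ b.2⟩
  let G : X → unitInterval → X := fun x t =>
    if h : ∃ b, x ∈ F b then H h.choose (⟨x, h.choose_spec⟩, t) else x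
  have hG : ∀ (b : B) (x : X) (hx : x ∈ F b) t, G x t = H b (⟨x, hx⟩, t) := by
    intro b x hx t
    have h : ∃ b, x ∈ F b := ⟨b, hx⟩
    have key : ∀ b' (hx' : x ∈ F b'), (H b' (⟨x, hx'⟩, t) : X) = H b (⟨x, hx⟩, t) := by
      intro b' hx'
      obtain rfl := huniq hx hx'
      rfl
    simp only [G, dif_pos h]
    exact key _ h.choose_spec
  refine ⟨G, ⋃ b, F b, fun i => i.elim Bᶜ fun b => interior (F b), ?_, ?_, rfl, ?_, ?_, ?_⟩
  · rintro (_ | b)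
    exacts [hB.isOpen_compl, isOpen_interior]
  · intro x
    by_cases hx : x ∈ B
    · exact ⟨some ⟨x, hx⟩, mem_interior_iff_mem_nhds.2 (hnhds ⟨x, hx⟩)⟩
    · exact ⟨none, hx⟩
  · intro x hx
    obtain ⟨b, hx⟩ := Set.mem_iUnion.1 hx
    rw [hG b x hx, H0]
  · intro x hx t
    obtain ⟨b, hx⟩ := Set.mem_iUnion.1 hx
    rw [hG b x hx, hmemB (Subtype.prop _), hmemB hx]
    have := Hb b ⟨x, hx⟩ t
    rwa [Subtype.ext_iff, Subtype.ext_iff] at this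
  · intro b n σ hσ
    have hσ' : ∀ x, σ x ∈ F b := fun x => interior_subset (hσ x)
    refine ⟨fun x => Set.mem_iUnion.2 ⟨b, hσ' x⟩, ?_, fun x x' => ?_⟩
    · have : (fun p : TopSimplex n × unitInterval => G (σ p.1) p.2) =
          fun p => (H b (⟨σ p.1, hσ' p.1⟩, p.2) : X) := funext fun p => hG b _ _ _
      rw [this]
      fun_prop
    · rw [hG b _ (hσ' x), hG b _ (hσ' x'), H1, H1]

/-- The quotient of singular chains by admissible chains is acyclic. -/
lemma IsMarkedSpace.exists_sub_boundary_mem (hXB : IsMarkedSpace X B) {n : ℕ}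
    (c : SingularChain R X (n + 1)) (hc : boundary R X n c ∈ admissibleChains R X B n) :
    ∃ e, c - boundary R X (n + 1) e ∈ admissibleChains R X B (n + 1) := by
  obtain ⟨G, D, U, hU, hcover, hnone, hG0, hGB, hcon⟩ := hXB.exists_contraction
  have hcone : ∀ {m : ℕ} {a : SingularChain R X m}, a ∈ admissibleChains R X B m →
      coneOp R G D m a ∈ admissibleChains R X B (m + 1) := fun {m a} ha =>
    coneOp_mem_chainsOf (S := {σ | Admissible B σ}) (S' := {σ | Admissible B σ})
      (fun _ hσ h => admissible_coneSimplex hGB hσ h) ha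
  have hsmall : ∀ a ∈ chainsOf R (smallSimplices U (n + 1)),
      a - coneOp R G D n (boundary R X n a) -
        boundary R X (n + 1) (coneOp R G D (n + 1) a) ∈ admissibleChains R X B (n + 1) := by
    intro a ha
    refine map_mem_of_mem_chainsOf (LinearMap.id - coneOp R G D n ∘ₗ boundary R X n -
      boundary R X (n + 1) ∘ₗ coneOp R G D (n + 1)) _ (fun σ hσ => ?_) ha
    simp only [LinearMap.sub_apply, LinearMap.comp_apply, LinearMap.id_apply]
    by_cases h : Conable G D σ
    · rw [boundary_coneOp_single hG0 h, sub_self]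
      exact zero_mem _
    · have hadm : Finsupp.single σ 1 ∈ admissibleChains R X B (n + 1) := by
        obtain ⟨_ | b, hσ⟩ := hσ
        · exact single_mem_chainsOf (S := {σ | Admissible B σ})
            (admissible_of_forall_notMem fun x => by have := hσ x; rwa [hnone] at this)
        · exact absurd (hcon b _ σ hσ) h
      rw [coneOp_single_of_not h, map_zero, sub_zero]
      exact sub_mem hadm (hcone (boundary_mem_admissibleChains hadm))
  obtain ⟨N, hN⟩ := exists_subdiv_pow_mem_small (R := R) hU hcover c
  induction N generalizing c with
  | zero =>
    refine ⟨coneOp R G D (n + 1) c, ?_⟩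
    have := add_mem (hsmall c hN) (hcone hc)
    rwa [sub_right_comm, sub_add_cancel] at this
  | succ N ih =>
    rw [pow_succ, Module.End.mul_apply] at hN
    obtain ⟨e, he⟩ := ih (subdiv R X (n + 1) c)
      (by rw [boundary_subdiv]; exact subdiv_mem_admissibleChains hc) hN
    refine ⟨e + subdivHomotopy R X (n + 1) c, ?_⟩
    have := add_mem he (subdivHomotopy_mem_admissibleChains hc)
    rw [map_add, boundary_subdivHomotopy]
    convert this using 1
    abel

end Marked

/-- For a marked space `(X, B)`, the inclusion of marked chains into relative singular
chains induces an isomorphism `H^M_n(X,B;R) → H_n(X,B;R)` in every degree: it is injective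
(a marked cycle which is a relative boundary is a marked boundary) and surjective (every
relative cycle is relatively homologous to a marked cycle). -/
theorem marked_homology_iso_relative_homology {X : Type*} [TopologicalSpace X] {B : Set X}
    (hXB : IsMarkedSpace X B) (R : Type*) [Ring R] (n : ℕ) :
    (∀ c ∈ markedCycles R X B n, c ∈ relativeBoundaries R X B n →
        c ∈ markedBoundaries R X B n) ∧
    (∀ z ∈ relativeCycles R X B n, ∃ c ∈ markedCycles R X B n,
        z - c ∈ relativeBoundaries R X B n) := by
  have hle := chainsIn_le_admissibleChains (R := R) (B := B)
  refine ⟨fun c hc hcb => ?_, fun z hz => ?_⟩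
  · obtain ⟨_, ⟨d, -, rfl⟩, β, hβ, rfl⟩ := Submodule.mem_sup.1 hcb
    have hcadm : boundary R X n d + β ∈ admissibleChains R X B n := by
      cases n with
      | zero => exact hc
      | succ n => exact hc.1
    obtain ⟨e, he⟩ := hXB.exists_sub_boundary_mem d
      (by simpa using sub_mem hcadm (hle n hβ))
    refine Submodule.mem_sup.2 ⟨_, ⟨_, he, ?_⟩, β, hβ, rfl⟩
    rw [map_sub, boundary_boundary, sub_zero]
  · cases n with
    | zero =>
      refine ⟨z, ?_, by simp⟩
      change z ∈ admissibleChains R X B 0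
      rw [admissibleChains_zero]
      trivial
    | succ n =>
      obtain ⟨e, he⟩ := hXB.exists_sub_boundary_mem z (hle n hz)
      refine ⟨z - boundary R X (n + 1) e, ⟨he, ?_⟩, ?_⟩
      · change boundary R X n _ ∈ chainsIn R X B n
        rw [map_sub, boundary_boundary, sub_zero]
        exact hz
      · rw [sub_sub_cancel]
        exact Submodule.mem_sup_left ⟨e, trivial, rfl⟩
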